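/- arXiv:2211.07822 — 7 statements merged into one kernel-verified Lean document; each statement's English description precedes it below -/
import Mathlib

section
/- Let n ≥ k+1 and let P be a k-stable property of graphs on a fixed vertex set of size n such that the complete graph K_n has property P. Suppose G is a graph on this vertex set with minimum degree at least d that does not have property P. Then there exists an integer q with d ≤ q ≤ (k-1)/2 such that G has the (n-k+q, q)-Pósa property. -/
open SimpleGraph

/-- The degree of a vertex `v` in a graph `G` (as the cardinality of its neighbor set). -/
noncomputable def degN {V : Type*} (G : SimpleGraph V) (v : V) : ℕ :=
  (G.neighborSet v).ncard

/-- A linear forest: an acyclic graph all of whose vertices have degree at most `2`,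
i.e. a forest whose connected components are paths and isolated vertices. -/
def IsLinearForest {V : Type*} (H : SimpleGraph V) : Prop :=
  H.IsAcyclic ∧ ∀ v, degN H v ≤ 2

/-- `G` is `𝓛ₖ`-free: it contains no linear forest with exactly `k` edges as a subgraph. -/
def LinearForestFree {V : Type*} (k : ℕ) (G : SimpleGraph V) : Prop :=
  ∀ H : SimpleGraph V, H ≤ G → IsLinearForest H → H.edgeSet.ncard ≠ k

/-- `Nr r G` is the number of `r`-cliques of `G`. -/
noncomputable def Nr {V : Type*} (r : ℕ) (G : SimpleGraph V) : ℕ :=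
  {s : Finset V | G.IsNClique r s}.ncard

/-- `hr r n k a = C(k-a, r) + (n-k+a) * C(a, r-1)` (as an integer). -/
def hr (r n k a : ℕ) : ℤ :=
  (Nat.choose (k - a) r : ℤ) + ((n : ℤ) - (k : ℤ) + (a : ℤ)) * (Nat.choose a (r - 1) : ℤ)

/-- The graph `H(n,k,a)`: vertices `0,…,a-1` form the set `A`, vertices `a,…,k-a-1` form
the set `B`, the remaining `n-k+a` vertices form the set `C`; the edges are all edges inside
`A ∪ B` together with all edges between `A` and `C`. -/
def HGraph (n k a : ℕ) : SimpleGraph (Fin n) :=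
  SimpleGraph.fromRel (fun u v => (u : ℕ) < a ∨ ((u : ℕ) < k - a ∧ (v : ℕ) < k - a))

/-- `H⁺(n,k,a)`: the graph `H(n,k,a)` with one extra edge inside `C`
(between the first two vertices of `C`). -/
def HplusGraph (n k a : ℕ) : SimpleGraph (Fin n) :=
  SimpleGraph.fromRel (fun u v => (u : ℕ) < a ∨ ((u : ℕ) < k - a ∧ (v : ℕ) < k - a)
    ∨ ((u : ℕ) = k - a ∧ (v : ℕ) = k - a + 1))

/-- `H⁺⁺(n,k,a)`: the graph `H(n,k,a)` with two extra independent edges inside `C`. -/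
def HplusplusGraph (n k a : ℕ) : SimpleGraph (Fin n) :=
  SimpleGraph.fromRel (fun u v => (u : ℕ) < a ∨ ((u : ℕ) < k - a ∧ (v : ℕ) < k - a)
    ∨ ((u : ℕ) = k - a ∧ (v : ℕ) = k - a + 1)
    ∨ ((u : ℕ) = k - a + 2 ∧ (v : ℕ) = k - a + 3))

/-- `G` is isomorphic to a subgraph of `H`. -/
def IsoSubgraph {V W : Type*} (G : SimpleGraph V) (H : SimpleGraph W) : Prop :=
  ∃ f : V ↪ W, ∀ u v, G.Adj u v → H.Adj (f u) (f v)

/-- The degree of a vertex is monotone in the graph. -/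
theorem degN_mono {V : Type*} [Finite V] {G H : SimpleGraph V} (h : G ≤ H) (v : V) :
    degN G v ≤ degN H v :=
  Set.ncard_le_ncard (fun _ hw => h hw) (Set.toFinite _)

/-- The neighbors of `v`, the non-neighbors of `v` and `v` itself exhaust the vertex set. -/
theorem degN_add_ncard_neighborSet_compl {V : Type*} [Fintype V] (G : SimpleGraph V) (v : V) :
    degN G v + (Gᶜ.neighborSet v).ncard + 1 = Fintype.card V := by
  classical
  have h := G.degree_compl v
  have hlt := G.degree_lt_card_verts v
  rw [← card_neighborSet_eq_degree, ← card_neighborSet_eq_degree] at h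
  rw [← card_neighborSet_eq_degree] at hlt
  simp only [degN, Set.ncard_eq_toFinset_card', Set.toFinset_card]
  omega

/-- A non-complete graph has distinct non-adjacent vertices `u` and `v` with `d(u) ≤ d(v)` such that
no non-neighbor of `v` has degree larger than `d(u)`. -/
theorem exists_not_adj_forall_degN_le {V : Type*} [Finite V] {G : SimpleGraph V} (hG : G ≠ ⊤) :
    ∃ u v, Gᶜ.Adj v u ∧ degN G u ≤ degN G v ∧ ∀ w, Gᶜ.Adj v w → degN G w ≤ degN G u := by
  obtain ⟨a, b, hab, hnab⟩ := ne_top_iff_exists_not_adj.mp hG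
  obtain ⟨⟨x, y⟩, hxy, hmax⟩ := (Set.toFinite {p : V × V | Gᶜ.Adj p.1 p.2}).exists_maximalFor
    (fun p => degN G p.1 + degN G p.2) _ ⟨(a, b), (G.compl_adj a b).mpr ⟨hab, hnab⟩⟩
  replace hmax : ∀ s t, Gᶜ.Adj s t → degN G s + degN G t ≤ degN G x + degN G y := by
    intro s t hst
    by_contra! hlt
    exact hlt.not_ge (hmax (j := (s, t)) hst hlt.le)
  change Gᶜ.Adj x y at hxy
  rcases le_total (degN G x) (degN G y) with h | h
  · refine ⟨x, y, hxy.symm, h, fun w hw => ?_⟩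
    have := hmax y w hw
    omega
  · refine ⟨y, x, hxy, h, fun w hw => ?_⟩
    have := hmax x w hw
    omega

/-- Let `n ≥ k+1` and let `P` be a `k`-stable property of graphs on a fixed
vertex set of size `n` which holds for the complete graph. If `G` has minimum degree at least
`d` and does not have property `P`, then there is an integer `q` with `d ≤ q ≤ (k-1)/2` such
that at least `n-k+q` vertices of `G` have degree at most `q` (the `(n-k+q, q)`-Pósa
property). -/
theorem statement11 {V : Type*} [Fintype V] (n k d : ℕ) (hcard : Fintype.card V = n)
    (hn : k + 1 ≤ n) (P : SimpleGraph V → Prop)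
    (hstable : ∀ (G : SimpleGraph V) (u v : V), u ≠ v → ¬ G.Adj u v →
      k ≤ degN G u + degN G v → P (G ⊔ SimpleGraph.fromEdgeSet {s(u, v)}) → P G)
    (hcomplete : P ⊤)
    (G : SimpleGraph V) (hmindeg : ∀ v, d ≤ degN G v) (hP : ¬ P G) :
    ∃ q : ℕ, d ≤ q ∧ 2 * q < k ∧ n - k + q ≤ {v : V | degN G v ≤ q}.ncard := by
  obtain ⟨H, hGH, hH⟩ := (Set.toFinite {H : SimpleGraph V | ¬ P H}).exists_le_maximal hP
  have hHP : ¬ P H := hH.prop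
  have hsum : ∀ u v, Hᶜ.Adj v u → degN H u + degN H v < k := by
    intro u v huv
    rw [compl_adj] at huv
    by_contra! hk
    have hsup : ¬ P (H ⊔ fromEdgeSet {s(v, u)}) := fun h =>
      hHP (hstable H v u huv.1 huv.2 (by omega) h)
    refine huv.2 (hH.le_of_ge hsup le_sup_left ?_)
    simp [huv.1]
  obtain ⟨u, v, huv, hle, hmax⟩ := exists_not_adj_forall_degN_le
    (fun h : H = ⊤ => hHP (h ▸ hcomplete))
  have hlt := hsum u v huv
  have hcount := degN_add_ncard_neighborSet_compl H v
  have hsub : (Hᶜ.neighborSet v).ncard ≤ {w : V | degN G w ≤ degN H u}.ncard :=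
    Set.ncard_le_ncard (fun w hw => (degN_mono hGH w).trans (hmax w hw)) (Set.toFinite _)
  exact ⟨degN H u, (hmindeg u).trans (degN_mono hGH u), by omega, by omega⟩
end

section
/- Suppose G is a graph on n vertices that is stable under taking k-closure, and let q be the minimum integer such that G has the (n-k+q, q)-Pósa property; assume q ≤ (k-1)/2. Let T be the set of vertices of G with degree at least k-q and let T' = V(G) \ T. Then every vertex of T is adjacent to every vertex of T', i.e., the bipartite graph between T and T' is complete. -/
open SimpleGraph

/-- In a graph stable under `k`-closure, a vertex of degree `d < k` forces at least
`n - 1 - d` vertices of degree at most `k - 1 - d`. -/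
theorem card_le_ncard_degN_le_of_stable {V : Type*} [Fintype V] (G : SimpleGraph V) (k : ℕ)
    (hstable : ∀ u v : V, u ≠ v → ¬ G.Adj u v → degN G u + degN G v < k) (u : V) :
    Fintype.card V ≤ {w : V | degN G w ≤ k - 1 - degN G u}.ncard + degN G u + 1 := by
  have hcover : (Set.univ : Set V) ⊆
      {w : V | degN G w ≤ k - 1 - degN G u} ∪ insert u (G.neighborSet u) := by
    intro w _
    by_cases hw : w ∈ insert u (G.neighborSet u)
    · exact Or.inr hw
    · simp only [Set.mem_insert_iff, mem_neighborSet, not_or] at hw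
      have := hstable u w (Ne.symm hw.1) hw.2
      exact Or.inl (by simp only [Set.mem_ofPred_eq]; omega)
  calc Fintype.card V = (Set.univ : Set V).ncard := by
        rw [Set.ncard_univ, Nat.card_eq_fintype_card]
    _ ≤ _ := Set.ncard_le_ncard hcover (Set.toFinite _)
    _ ≤ _ := Set.ncard_union_le _ _
    _ ≤ _ := by
        have := Set.ncard_insert_le u (G.neighborSet u)
        unfold degN at *
        omega

/-- Suppose `G` is a graph on `n` vertices stable under taking `k`-closure,
and `q ≤ (k-1)/2` is the minimum integer such that `G` has the `(n-k+q, q)`-Pósa property.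
If `T` is the set of vertices of degree at least `k-q` and `T' = V ∖ T`, then every vertex
of `T` is adjacent to every vertex of `T'`. -/
theorem statement12 {V : Type*} [Fintype V] (G : SimpleGraph V) (n k q : ℕ)
    (hcard : Fintype.card V = n)
    (hstable : ∀ u v : V, u ≠ v → ¬ G.Adj u v → degN G u + degN G v < k)
    (hposa : ((n : ℤ) - k + q) ≤ ({v : V | degN G v ≤ q}.ncard : ℤ))
    (hmin : ∀ q' : ℕ, q' < q →
      ¬ (((n : ℤ) - k + q') ≤ ({v : V | degN G v ≤ q'}.ncard : ℤ)))
    (hq : 2 * q < k) :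
    ∀ u v : V, k - q ≤ degN G u → degN G v < k - q → G.Adj u v := by
  intro u v hu hv
  by_contra hadj
  have hne : u ≠ v := by
    rintro rfl
    omega
  have hlt := hstable u v hne hadj
  have hcount := card_le_ncard_degN_le_of_stable G k hstable u
  refine hmin (k - 1 - degN G u) (by omega) ?_
  omega
end

section
/- Let k ≥ 1 and let G be a graph with maximum degree at most 2 that contains no linear forest with k+1 edges as a subgraph. Then G has at most 3k/2 edges. -/
open SimpleGraph

theorem degN_eq_degree {V : Type*} (G : SimpleGraph V) (v : V) [Fintype (G.neighborSet v)] :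
    degN G v = G.degree v := by
  rw [degN, ← Nat.card_coe_set_eq, Nat.card_eq_fintype_card, card_neighborSet_eq_degree]

/-- In a connected component with `n` vertices the degrees sum to at least `2 * (n - 1)`. -/
theorem SimpleGraph.ConnectedComponent.two_mul_card_le_sum_degree_add_two {V : Type*} [Fintype V]
    {F : SimpleGraph V} [DecidableRel F.Adj] [DecidableEq F.ConnectedComponent]
    (C : F.ConnectedComponent) :
    2 * (Finset.univ.filter fun v => F.connectedComponentMk v = C).card ≤
      (∑ v with F.connectedComponentMk v = C, F.degree v) + 2 := by
  classical
  have hmem : ∀ v, v ∈ Finset.univ.filter (fun v => F.connectedComponentMk v = C) ↔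
      v ∈ C.supp := by simp
  have hsum : ∑ v with F.connectedComponentMk v = C, F.degree v =
      ∑ v : C.supp, (F.induce C.supp).degree v := by
    rw [Finset.sum_subtype _ hmem (fun v => F.degree v)]
    refine Finset.sum_congr rfl fun v _ => (degree_induce_of_neighborSet_subset ?_).symm
    intro w hw
    exact (C.mem_supp_congr_adj hw).1 v.2
  have hconn : (F.induce C.supp).Connected := C.connected_toSimpleGraph
  have hcard := hconn.card_vert_le_card_edgeSet_add_one
  rw [Nat.card_eq_fintype_card, Nat.card_eq_fintype_card, ← edgeFinset_card] at hcard
  rw [Fintype.card_of_subtype _ hmem] at hcard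
  rw [hsum, sum_degrees_eq_twice_card_edges]
  omega

/-- For `k ≥ 1`, a graph with maximum degree at most `2` each of whose
linear-forest subgraphs has at most `k` edges has at most `3k/2` edges. -/
theorem statement13 {V : Type*} [Fintype V] (G : SimpleGraph V) (k : ℕ) (hk : 1 ≤ k)
    (hdeg : ∀ v, degN G v ≤ 2)
    (hfree : ∀ H : SimpleGraph V, H ≤ G → IsLinearForest H → H.edgeSet.ncard ≤ k) :
    2 * G.edgeSet.ncard ≤ 3 * k := by
  classical
  obtain ⟨F, hFG, hF, hreach⟩ := G.exists_isAcyclic_reachable_eq_le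
  simp only [degN_eq_degree] at hdeg
  have hFdeg : ∀ v, degN F v ≤ 2 := fun v => by
    rw [degN_eq_degree]
    exact (degree_le_of_le hFG).trans (hdeg v)
  have hFk := hfree F hFG ⟨hF, hFdeg⟩
  rw [← coe_edgeFinset, Set.ncard_coe_finset] at hFk ⊢
  have key : ∀ C : F.ConnectedComponent,
      2 * (∑ v with F.connectedComponentMk v = C, G.degree v) ≤
        3 * ∑ v with F.connectedComponentMk v = C, F.degree v := by
    intro C
    have hF2 := C.two_mul_card_le_sum_degree_add_two
    set S := Finset.univ.filter fun v => F.connectedComponentMk v = C with hS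
    have h2 : ∑ v ∈ S, G.degree v ≤ S.card * 2 :=
      Finset.sum_le_card_nsmul _ _ _ fun v _ => hdeg v
    have hn : ∑ v ∈ S, G.degree v ≤ S.card * (S.card - 1) := by
      refine Finset.sum_le_card_nsmul _ _ _ fun v hv => ?_
      rw [← Finset.card_erase_of_mem hv, ← card_neighborFinset_eq_degree]
      refine Finset.card_le_card fun w hw => ?_
      rw [mem_neighborFinset] at hw
      have hvw : F.Reachable w v := hreach ▸ hw.symm.reachable
      simp only [hS, Finset.mem_filter, Finset.mem_univ, true_and] at hv
      simp [hS, hw.ne', ← hv, hvw]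
    generalize S.card = n at *
    rcases lt_or_ge n 3 with h | h
    · interval_cases n <;> omega
    · omega
  have hsum := Finset.sum_le_sum fun C (_ : C ∈ Finset.univ) => key C
  have hfib (d : V → ℕ) :
      ∑ C : F.ConnectedComponent, ∑ v with F.connectedComponentMk v = C, d v = ∑ v, d v := by
    convert Finset.sum_fiberwise Finset.univ F.connectedComponentMk d
  rw [← Finset.mul_sum, ← Finset.mul_sum, hfib, hfib, sum_degrees_eq_twice_card_edges,
    sum_degrees_eq_twice_card_edges] at hsum
  omega
end

section
/- Let k be a positive integer divisible by 3, and let G be the disjoint union of k/3 copies of the complete graph K_4. Then G has maximum degree 3, G contains no linear forest with k+1 edges as a subgraph, and G has exactly 2k edges. -/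
open SimpleGraph

theorem sum_degN_eq_two_mul_ncard_edgeSet {V : Type*} [Fintype V] (G : SimpleGraph V) :
    ∑ v, degN G v = 2 * G.edgeSet.ncard := by
  classical
  rw [← coe_edgeFinset, Set.ncard_coe_finset, ← sum_degrees_eq_twice_card_edges]
  refine Finset.sum_congr rfl fun v _ => ?_
  rw [degN, ← Nat.card_coe_set_eq, Nat.card_eq_fintype_card, card_neighborSet_eq_degree]

theorem degN_comap_prodMk {ι α : Type*} {H : SimpleGraph (ι × α)}
    (hH : ∀ u v, H.Adj u v → u.1 = v.1) (i : ι) (a : α) :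
    degN (H.comap (Prod.mk i)) a = degN H (i, a) := by
  have himage : H.neighborSet (i, a) =
      Prod.mk i '' (H.comap (Prod.mk i)).neighborSet a := by
    ext ⟨j, b⟩
    simp only [mem_neighborSet, Set.mem_image, comap_adj, Prod.mk.injEq]
    constructor
    · intro h
      obtain rfl : i = j := hH _ _ h
      exact ⟨b, h, rfl, rfl⟩
    · rintro ⟨b, h, rfl, rfl⟩
      exact h
  rw [degN, degN, himage, Set.ncard_image_of_injective _ (Prod.mk_right_injective i)]

theorem ncard_edgeSet_eq_sum_comap {ι α : Type*} [Fintype ι] [Fintype α]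
    {H : SimpleGraph (ι × α)} (hH : ∀ u v, H.Adj u v → u.1 = v.1) :
    H.edgeSet.ncard = ∑ i, (H.comap (Prod.mk i)).edgeSet.ncard := by
  apply Nat.eq_of_mul_eq_mul_left two_pos
  rw [← sum_degN_eq_two_mul_ncard_edgeSet, Fintype.sum_prod_type, Finset.mul_sum]
  refine Finset.sum_congr rfl fun i _ => ?_
  rw [← sum_degN_eq_two_mul_ncard_edgeSet]
  exact Finset.sum_congr rfl fun a _ => (degN_comap_prodMk hH i a).symm

theorem SimpleGraph.IsAcyclic.ncard_edgeSet_add_one_le {V : Type*} [Finite V] [Nonempty V]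
    {F : SimpleGraph V} (hF : F.IsAcyclic) : F.edgeSet.ncard + 1 ≤ Nat.card V := by
  obtain ⟨T, hFT, hT⟩ := (Set.toFinite {T : SimpleGraph V | T.IsAcyclic}).exists_le_maximal hF
  have htree : T.IsTree := isTree_iff_maximal_isAcyclic.2 ⟨‹_›, hT⟩
  rw [← (isTree_iff_connected_and_card.1 htree).2, Nat.card_coe_set_eq]
  exact Nat.add_le_add_right
    (Set.ncard_le_ncard (edgeSet_mono hFT) (Set.toFinite _)) 1

/-- For `k` positive and divisible by `3`, the disjoint union of `k/3`
copies of `K₄` has maximum degree `3`, contains no linear forest with `k+1` edges as a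
subgraph (every linear-forest subgraph has at most `k` edges), and has exactly `2k` edges. -/
theorem statement15 (k : ℕ) (hk : 0 < k) (h3 : 3 ∣ k)
    (G : SimpleGraph (Fin (k / 3) × Fin 4))
    (hG : G = SimpleGraph.fromRel (fun u v => u.1 = v.1)) :
    (∀ v, degN G v ≤ 3) ∧ (∃ v, degN G v = 3) ∧
      (∀ H : SimpleGraph (Fin (k / 3) × Fin 4), H ≤ G → IsLinearForest H →
        H.edgeSet.ncard ≤ k) ∧
      G.edgeSet.ncard = 2 * k := by
  have hfst : ∀ u v, G.Adj u v → u.1 = v.1 := by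
    subst hG
    rintro u v ⟨-, h | h⟩
    exacts [h, h.symm]
  have htop : ∀ i, G.comap (Prod.mk i) = ⊤ := by
    subst hG
    intro i
    ext a b
    simp
  have hdeg : ∀ v, degN G v = 3 := by
    rintro ⟨i, a⟩
    rw [← degN_comap_prodMk hfst, htop, degN, ← Nat.card_coe_set_eq,
      Nat.card_eq_fintype_card, card_neighborSet_eq_degree, complete_graph_degree, Fintype.card_fin]
  obtain ⟨m, rfl⟩ := h3
  have hm : 3 * m / 3 = m := Nat.mul_div_cancel_left m three_pos
  refine ⟨fun v => (hdeg v).le, ⟨(⟨0, by omega⟩, 0), hdeg _⟩, fun H hH hlin => ?_, ?_⟩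
  · rw [ncard_edgeSet_eq_sum_comap fun u v h => hfst u v (hH h)]
    have hle : ∀ i ∈ Finset.univ, (H.comap (Prod.mk i)).edgeSet.ncard ≤ 3 := fun i _ => by
      have hcomap : (H.comap (Prod.mk i)).IsAcyclic :=
        hlin.1.of_comap ⟨Prod.mk i, Prod.mk_right_injective i⟩
      simpa [Nat.lt_succ_iff] using hcomap.ncard_edgeSet_add_one_le
    refine (Finset.sum_le_card_nsmul _ _ _ hle).trans ?_
    simp only [Finset.card_univ, Fintype.card_fin, smul_eq_mul]
    omega
  · have hsum := sum_degN_eq_two_mul_ncard_edgeSet G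
    simp only [hdeg, Finset.sum_const, Finset.card_univ, Fintype.card_prod, Fintype.card_fin,
      smul_eq_mul] at hsum
    omega
end

section
/- Let r ≥ 3 be an integer and let x ≥ r be a real number. Then every graph with exactly x(x-1)/2 edges contains at most x(x-1)(x-2)⋯(x-r+1)/r! cliques of order r, where x(x-1)⋯(x-r+1)/r! is the generalized binomial coefficient C(x,r). -/
open SimpleGraph

/-- The subgraph of `G` formed by the edges whose two ends are both adjacent to `v`. -/
def SimpleGraph.link {V : Type*} (G : SimpleGraph V) (v : V) : SimpleGraph V where
  Adj a b := G.Adj a b ∧ G.Adj v a ∧ G.Adj v b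
  symm := ⟨fun _ _ h => ⟨h.1.symm, h.2.2, h.2.1⟩⟩
  loopless := ⟨fun _ h => h.1.ne rfl⟩

open Classical in
theorem SimpleGraph.succ_mul_card_cliqueFinset_succ_le {V : Type*} [Fintype V]
    (G : SimpleGraph V) (r : ℕ) :
    (r + 1) * (G.cliqueFinset (r + 1)).card ≤ ∑ v, ((G.link v).cliqueFinset r).card := by
  have hcount : ∑ s ∈ G.cliqueFinset (r + 1), s.card =
      ∑ v, ((G.cliqueFinset (r + 1)).filter (v ∈ ·)).card := by
    simp only [Finset.card_filter]
    rw [Finset.sum_comm]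
    simp
  have hsum : ∑ s ∈ G.cliqueFinset (r + 1), s.card =
      (r + 1) * (G.cliqueFinset (r + 1)).card := by
    rw [Finset.sum_congr rfl fun s hs => (mem_cliqueFinset_iff.1 hs).card_eq]
    simp [mul_comm]
  rw [← hsum, hcount]
  refine Finset.sum_le_sum fun v _ => ?_
  refine Finset.card_le_card_of_injOn (·.erase v) ?_ ?_
  · intro s hs
    obtain ⟨hs, hv⟩ := Finset.mem_filter.1 hs
    rw [mem_cliqueFinset_iff] at hs
    refine Finset.mem_coe.2 (mem_cliqueFinset_iff.2 ⟨?_, by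
      simp only [Finset.card_erase_of_mem hv, hs.card_eq, Nat.add_sub_cancel]⟩)
    intro a ha b hb hab
    obtain ⟨hav, ha⟩ := Finset.mem_erase.1 ha
    obtain ⟨hbv, hb⟩ := Finset.mem_erase.1 hb
    exact ⟨hs.isClique ha hb hab, hs.isClique hv ha hav.symm, hs.isClique hv hb hbv.symm⟩
  · intro s hs t ht h
    rw [← Finset.insert_erase (Finset.mem_filter.1 hs).2,
      ← Finset.insert_erase (Finset.mem_filter.1 ht).2]
    exact congrArg (insert v) h

open Classical in
theorem SimpleGraph.two_mul_card_edgeFinset_link_le {V : Type*} [Fintype V]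
    (G : SimpleGraph V) (v : V) :
    2 * (G.link v).edgeFinset.card ≤ G.degree v * (G.degree v - 1) := by
  rw [← sum_degrees_eq_twice_card_edges,
    ← Finset.sum_subset (Finset.subset_univ (G.neighborFinset v))]
  · refine (Finset.sum_le_card_nsmul _ _ (G.degree v - 1) fun u hu => ?_).trans (by simp)
    rw [← card_neighborFinset_eq_degree, ← card_neighborFinset_eq_degree,
      ← Finset.card_erase_of_mem hu]
    refine Finset.card_le_card fun w hw => ?_
    rw [mem_neighborFinset] at hw
    simpa [hw.2.2] using hw.1.ne'
  · intro u _ hu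
    rw [mem_neighborFinset] at hu
    rw [degree_eq_zero]
    exact fun w hw => hu hw.2.1

open Classical in
theorem SimpleGraph.card_edgeFinset_link_add_degree_le {V : Type*} [Fintype V]
    (G : SimpleGraph V) (v : V) :
    (G.link v).edgeFinset.card + G.degree v ≤ G.edgeFinset.card := by
  rw [← card_incidenceFinset_eq_degree, ← Finset.card_union_of_disjoint]
  · refine Finset.card_le_card (Finset.union_subset ?_ (G.incidenceFinset_subset v))
    exact edgeFinset_mono fun _ _ h => h.1
  · rw [Finset.disjoint_left]
    intro e he hv
    induction e with | _ a b
    rw [mem_edgeFinset, mem_edgeSet] at he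
    rw [mem_incidenceFinset] at hv
    rcases Sym2.mem_iff.1 hv.2 with rfl | rfl
    · exact he.2.1.ne rfl
    · exact he.2.2.ne rfl

open Classical in
theorem SimpleGraph.card_cliqueFinset_two_le {V : Type*} [Fintype V] (G : SimpleGraph V) :
    (G.cliqueFinset 2).card ≤ G.edgeFinset.card := by
  refine (Finset.card_le_card (t := G.edgeFinset.image Sym2.toFinset) fun s hs => ?_).trans
    Finset.card_image_le
  obtain ⟨a, b, hab, rfl⟩ := Finset.card_eq_two.1 (mem_cliqueFinset_iff.1 hs).card_eq
  refine Finset.mem_image.2 ⟨s(a, b), ?_, Sym2.toFinset_mk_eq⟩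
  rw [mem_edgeFinset, mem_edgeSet]
  exact (mem_cliqueFinset_iff.1 hs).isClique (by simp) (by simp) hab

open Classical in
theorem SimpleGraph.factorial_mul_card_cliqueFinset_le {V : Type*} [Fintype V] (k : ℕ)
    (G : SimpleGraph V) (x : ℝ) (hx : (k : ℝ) + 1 ≤ x)
    (hG : 2 * (G.edgeFinset.card : ℝ) ≤ x * (x - 1)) :
    ((k + 2).factorial : ℝ) * (G.cliqueFinset (k + 2)).card ≤
      2 * G.edgeFinset.card * ∏ i ∈ Finset.range k, (x - 2 - i) := by
  induction k generalizing G x with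
  | zero => simpa using G.card_cliqueFinset_two_le
  | succ k ih =>
    push_cast at hx
    have hk : (0 : ℝ) ≤ k := k.cast_nonneg
    have h_upper (v : V) :
        2 * ((G.link v).edgeFinset.card : ℝ) ≤ G.degree v * (G.degree v - 1) := by
      have h := G.two_mul_card_edgeFinset_link_le v
      rcases Nat.eq_zero_or_pos (G.degree v) with h0 | h0
      · rw [h0, Nat.zero_mul] at h
        rw [h0, Nat.cast_zero, zero_mul]
        exact_mod_cast h
      · rw [← Nat.cast_pred h0]
        exact_mod_cast h
    have h_compl (v : V) :
        ((G.link v).edgeFinset.card : ℝ) + G.degree v ≤ G.edgeFinset.card := by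
      exact_mod_cast G.card_edgeFinset_link_add_degree_le v
    have h_link (v : V) :
        2 * ((G.link v).edgeFinset.card : ℝ) ≤ (x - 1) * (x - 1 - 1) := by
      have h1 := h_upper v
      have h2 := h_compl v
      rcases le_total (G.degree v : ℝ) (x - 1) with h | h
      · have : (0 : ℝ) ≤ G.degree v := Nat.cast_nonneg _
        nlinarith
      · nlinarith
    have h_deg (v : V) :
        2 * ((G.link v).edgeFinset.card : ℝ) ≤ (x - 2) * G.degree v := by
      have h1 := h_upper v
      have h2 := h_compl v
      rcases le_total (G.degree v : ℝ) (x - 1) with h | h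
      · have : (0 : ℝ) ≤ G.degree v := Nat.cast_nonneg _
        nlinarith
      · nlinarith
    have h_prod : 0 ≤ ∏ i ∈ Finset.range k, (x - 1 - 2 - (i : ℝ)) := by
      refine Finset.prod_nonneg fun i hi => ?_
      have : (i : ℝ) + 1 ≤ k := by exact_mod_cast Finset.mem_range.1 hi
      linarith
    have h_sum : ∑ v, (G.degree v : ℝ) = 2 * G.edgeFinset.card := by
      exact_mod_cast G.sum_degrees_eq_twice_card_edges
    have h_clique : ((k + 2 : ℕ) + 1 : ℝ) * (G.cliqueFinset (k + 2 + 1)).card ≤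
        ∑ v, (((G.link v).cliqueFinset (k + 2)).card : ℝ) := by
      exact_mod_cast G.succ_mul_card_cliqueFinset_succ_le (k + 2)
    calc ((k + 1 + 2).factorial : ℝ) * (G.cliqueFinset (k + 1 + 2)).card
        = (k + 2).factorial * (((k + 2 : ℕ) + 1 : ℝ) * (G.cliqueFinset (k + 2 + 1)).card) := by
          rw [show k + 1 + 2 = k + 2 + 1 by ring, Nat.factorial_succ (k + 2)]
          push_cast
          ring
      _ ≤ (k + 2).factorial * ∑ v, (((G.link v).cliqueFinset (k + 2)).card : ℝ) := by
          gcongr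
      _ = ∑ v, (k + 2).factorial * (((G.link v).cliqueFinset (k + 2)).card : ℝ) :=
          Finset.mul_sum ..
      _ ≤ ∑ v, (x - 2) * G.degree v * ∏ i ∈ Finset.range k, (x - 1 - 2 - (i : ℝ)) :=
          Finset.sum_le_sum fun v _ => (ih (G.link v) (x - 1) (by linarith) (h_link v)).trans
            (mul_le_mul_of_nonneg_right (h_deg v) h_prod)
      _ = 2 * G.edgeFinset.card * ∏ i ∈ Finset.range (k + 1), (x - 2 - (i : ℝ)) := by
          rw [← Finset.sum_mul, ← Finset.mul_sum, h_sum, Finset.prod_range_succ']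
          have : ∀ i : ℕ, x - 1 - 2 - (i : ℝ) = x - 2 - (i + 1 : ℕ) := fun i => by
            push_cast
            ring
          simp only [this]
          push_cast
          ring

/-- Chakraborti–Chen. Let `r ≥ 3` be an integer and `x ≥ r` a real number.
Every graph with exactly `x(x-1)/2` edges contains at most
`x(x-1)⋯(x-r+1)/r! = C(x,r)` cliques of order `r`. -/
theorem statement16 {V : Type*} [Fintype V] (G : SimpleGraph V) (r : ℕ) (x : ℝ)
    (hr3 : 3 ≤ r) (hx : (r : ℝ) ≤ x)
    (hedges : (G.edgeSet.ncard : ℝ) = x * (x - 1) / 2) :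
    (Nr r G : ℝ) ≤ (∏ i ∈ Finset.range r, (x - i)) / (Nat.factorial r) := by
  classical
  obtain ⟨k, rfl⟩ := Nat.exists_eq_add_of_le' (show 2 ≤ r by omega)
  push_cast at hx
  have h_edges : (G.edgeFinset.card : ℝ) = x * (x - 1) / 2 := by
    rw [← hedges, ← coe_edgeFinset, Set.ncard_coe_finset]
  have h_cliques : Nr (k + 2) G = (G.cliqueFinset (k + 2)).card := by
    rw [← Set.ncard_coe_finset, coe_cliqueFinset]
    rfl
  have h_bound := G.factorial_mul_card_cliqueFinset_le k x (by linarith) (by linarith)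
  rw [h_cliques, le_div_iff₀ (by positivity), mul_comm]
  refine h_bound.trans_eq ?_
  rw [h_edges, Finset.prod_range_succ', Finset.prod_range_succ']
  have : ∀ i : ℕ, x - ((i + 1 + 1 : ℕ) : ℝ) = x - 2 - i := fun i => by
    push_cast
    ring
  simp only [this]
  push_cast
  ring
end

section
/- Let G be a graph on n vertices and suppose at least s vertices of G have degree at most q (i.e., G has the (s,q)-Pósa property). If n ≥ s + q and r ≥ 2, then N_r(G) ≤ C(n-s, r) + s·C(q, r-1). -/
open SimpleGraph

/-- Every `r`-clique either avoids `S` or consists of a vertex of `S` together with `r - 1` of its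
neighbours. -/
theorem cliques_subset_of_finset {V : Type*} [Fintype V] [DecidableEq V] (G : SimpleGraph V)
    [DecidableRel G.Adj] (S : Finset V) (r : ℕ) :
    {s : Finset V | G.IsNClique r s} ⊆
      ↑(Sᶜ.powersetCard r ∪ S.biUnion fun v =>
        ((G.neighborFinset v).powersetCard (r - 1)).image (insert v)) := by
  intro t ht
  rw [Finset.mem_coe, Finset.mem_union, Finset.mem_powersetCard, Finset.mem_biUnion]
  by_cases h : Disjoint t S
  · exact Or.inl ⟨Finset.subset_compl_iff_disjoint_right.mpr h, ht.card_eq⟩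
  · right
    obtain ⟨v, hvt, hvS⟩ := Finset.not_disjoint_iff.mp h
    refine ⟨v, hvS, Finset.mem_image.mpr ⟨t.erase v, Finset.mem_powersetCard.mpr ⟨?_, ?_⟩,
      Finset.insert_erase hvt⟩⟩
    · intro w hw
      obtain ⟨hwv, hwt⟩ := Finset.mem_erase.mp hw
      exact (G.mem_neighborFinset v w).mpr (ht.isClique hvt hwt hwv.symm)
    · rw [Finset.card_erase_of_mem hvt, ht.card_eq]

/-- If `G` is a graph on `n` vertices with at least `s` vertices of degree at
most `q` (the `(s,q)`-Pósa property), `n ≥ s+q` and `r ≥ 2`, then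
`Nᵣ(G) ≤ C(n-s, r) + s·C(q, r-1)`. -/
theorem statement17 {V : Type*} [Fintype V] (G : SimpleGraph V) (n s q r : ℕ)
    (hcard : Fintype.card V = n)
    (hposa : s ≤ {v : V | degN G v ≤ q}.ncard)
    (hn : s + q ≤ n) (hr2 : 2 ≤ r) :
    Nr r G ≤ Nat.choose (n - s) r + s * Nat.choose q (r - 1) := by
  classical
  obtain ⟨S, hS, hSs⟩ := Finset.exists_subset_card_eq
    (hposa.trans_eq (Set.ncard_eq_toFinset_card' _))
  have hdeg : ∀ v ∈ S, (G.neighborFinset v).card ≤ q := by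
    intro v hv
    have h := Set.mem_toFinset.mp (hS hv)
    rwa [Set.mem_ofPred_eq, degN, Set.ncard_eq_toFinset_card'] at h
  calc Nr r G
    _ ≤ _ := Set.ncard_le_ncard (cliques_subset_of_finset G S r) (Finset.finite_toSet _)
    _ = _ := Set.ncard_coe_finset _
    _ ≤ _ := Finset.card_union_le _ _
    _ ≤ Nat.choose (n - s) r + s * Nat.choose q (r - 1) := by
      refine Nat.add_le_add ?_ ?_
      · rw [Finset.card_powersetCard, Finset.card_compl, hcard, hSs]
      · rw [← hSs]
        refine Finset.card_biUnion_le_card_mul _ _ _ fun v hv => Finset.card_image_le.trans ?_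
        rw [Finset.card_powersetCard]
        exact Nat.choose_le_choose _ (hdeg v hv)
end

section
/- Let α ≥ 0 and r ≥ 2 be integers, and let G be a graph on n ≥ α+1 vertices such that every nonempty induced subgraph of G contains a vertex whose degree in that induced subgraph is at most α (equivalently, the (α+1)-core of G, obtained by iteratively deleting vertices of degree at most α, is empty). Then N_r(G) ≤ C(α+1, r) + (n-α-1)·C(α, r-1). -/
open SimpleGraph

open Classical in
/-- Adding a vertex with at most `α` neighbors in `t` to the vertex set `t` creates at most
`C(α, r)` new cliques of size `r + 1`. -/
lemma card_cliques_insert_le {V : Type*} (G : SimpleGraph V) {v : V} {t : Finset V} (hv : v ∉ t)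
    (r α : ℕ) (hdeg : (t.filter (G.Adj v)).card ≤ α) :
    (((insert v t).powersetCard (r + 1)).filter fun s : Finset V => G.IsClique s).card ≤
      ((t.powersetCard (r + 1)).filter fun s : Finset V => G.IsClique s).card + α.choose r := by
  have hsub : (((insert v t).powersetCard (r + 1)).filter fun s : Finset V => G.IsClique s) ⊆
      ((t.powersetCard (r + 1)).filter fun s : Finset V => G.IsClique s) ∪
        ((t.filter (G.Adj v)).powersetCard r).image (insert v) := by
    intro s hs
    rw [Finset.powersetCard_succ_insert hv, Finset.filter_union] at hs
    refine Finset.union_subset_union_right (fun s hs => ?_) hs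
    obtain ⟨hs, hclique⟩ := Finset.mem_filter.mp hs
    obtain ⟨u, hu, rfl⟩ := Finset.mem_image.mp hs
    obtain ⟨hut, hur⟩ := Finset.mem_powersetCard.mp hu
    refine Finset.mem_image_of_mem _ (Finset.mem_powersetCard.mpr ⟨fun x hx => ?_, hur⟩)
    refine Finset.mem_filter.mpr ⟨hut hx, hclique (by simp) (by simp [hx]) ?_⟩
    rintro rfl
    exact hv (hut hx)
  calc _ ≤ _ := Finset.card_le_card hsub
    _ ≤ _ := Finset.card_union_le _ _
    _ ≤ _ := by
      gcongr
      refine Finset.card_image_le.trans ?_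
      rw [Finset.card_powersetCard]
      exact Nat.choose_le_choose r hdeg

open Classical in
/-- In an `α`-degenerate graph, a set of `α + 1 + m` vertices spans at most
`C(α + 1, r + 1) + m * C(α, r)` cliques of size `r + 1`. -/
lemma card_cliques_le_of_degenerate {V : Type*} (G : SimpleGraph V) (α r : ℕ)
    (hG : ∀ t : Finset V, t.Nonempty → ∃ v ∈ t, (t.filter (G.Adj v)).card ≤ α) (m : ℕ) :
    ∀ t : Finset V, t.card = α + 1 + m →
      ((t.powersetCard (r + 1)).filter fun s : Finset V => G.IsClique s).card ≤
        (α + 1).choose (r + 1) + m * α.choose r := by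
  induction m with
  | zero =>
    intro t ht
    refine (Finset.card_filter_le _ _).trans ?_
    simp [ht]
  | succ m ih =>
    intro t ht
    obtain ⟨v, hv, hdeg⟩ := hG t (Finset.card_pos.mp (by omega))
    have hcard : (t.erase v).card = α + 1 + m := by
      rw [Finset.card_erase_of_mem hv]
      omega
    have hstep := card_cliques_insert_le G (Finset.notMem_erase v t) r α
      ((Finset.card_le_card (Finset.filter_subset_filter _ (Finset.erase_subset v t))).trans hdeg)
    rw [Finset.insert_erase hv] at hstep
    have := ih _ hcard
    rw [add_mul, one_mul]
    omega

/-- Let `α ≥ 0` and `r ≥ 2`, and let `G` be a graph on `n ≥ α+1` vertices such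
that every nonempty induced subgraph has a vertex of degree at most `α` in it (i.e. the
`(α+1)`-core of `G` is empty). Then `Nᵣ(G) ≤ C(α+1, r) + (n-α-1)·C(α, r-1)`. -/
theorem statement18 {V : Type*} [Fintype V] (G : SimpleGraph V) (n α r : ℕ)
    (hcard : Fintype.card V = n) (hn : α + 1 ≤ n) (hr2 : 2 ≤ r)
    (hdisint : ∀ s : Set V, s.Nonempty → ∃ v ∈ s, (G.neighborSet v ∩ s).ncard ≤ α) :
    Nr r G ≤ Nat.choose (α + 1) r + (n - α - 1) * Nat.choose α (r - 1) := by
  classical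
  obtain ⟨r, rfl⟩ : ∃ k, r = k + 1 := ⟨r - 1, by omega⟩
  have hG : ∀ t : Finset V, t.Nonempty → ∃ v ∈ t, (t.filter (G.Adj v)).card ≤ α := by
    intro t ht
    obtain ⟨v, hv, hdeg⟩ := hdisint t (by simpa using ht)
    refine ⟨v, by simpa using hv, ?_⟩
    rw [← Set.ncard_coe_finset]
    convert hdeg using 2
    ext x
    simp [and_comm]
  have hNr : Nr (r + 1) G =
      ((Finset.univ.powersetCard (r + 1)).filter fun s : Finset V => G.IsClique s).card := by
    rw [Nr, ← Set.ncard_coe_finset]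
    congr 1
    ext s
    simp [SimpleGraph.isNClique_iff, and_comm]
  rw [hNr, Nat.add_sub_cancel, Nat.sub_sub]
  refine card_cliques_le_of_degenerate G α r hG _ _ ?_
  rw [Finset.card_univ]
  omega
end
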